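/- For every k ≥ 1, R_{∧k,∧1}(u) · (R_{∧1,∧k}(−u))^{(21)} = (u+1)(k−u) · id as operators on V^{∧k} ⊗ V, where (·)^{(21)} denotes the same operator with the two tensor factors exchanged. -/

import Mathlib

noncomputable section
namespace Paper

def parN (m : ℕ) (c : ℕ) : ℕ := if c < m then 0 else 1
def par (m : ℕ) {N : ℕ} (a : Fin N) : ℕ := parN m a

variable {R : Type} [Ring R] {ι : Type} [Fintype ι] [DecidableEq ι] {N : ℕ}

def invExp (m : ℕ) (lt : ι → ι → Prop) [DecidableRel lt] (σ : Equiv.Perm ι)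
    (s : ι → Fin N) : ℕ :=
  ∑ p ∈ Finset.univ.filter (fun p : ι × ι => lt p.1 p.2 ∧ lt (σ p.2) (σ p.1)),
    par m (s p.1) * par m (s p.2)

def permMat (m : ℕ) (lt : ι → ι → Prop) [DecidableRel lt] (σ : Equiv.Perm ι) :
    Matrix (ι → Fin N) (ι → Fin N) R := fun r s =>
  if r = s ∘ σ.symm then (-1 : R) ^ invExp m lt σ s else 0

def embed (m : ℕ) (lt : ι → ι → Prop) [DecidableRel lt] (v : ι) (f : Fin N → Fin N → R) :
    Matrix (ι → Fin N) (ι → Fin N) R := fun r s =>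
  if ∀ w, w ≠ v → r w = s w then
    ((-1 : R) ^ ((par m (r v) + par m (s v)) *
        ∑ w ∈ Finset.univ.filter (fun w => lt w v), par m (s w))) * f (r v) (s v)
  else 0

def Eunit {N : ℕ} (a b : Fin N) : Fin N → Fin N → ℂ := fun c d => if c = a ∧ d = b then 1 else 0

def extL {k l : ℕ} (σ : Equiv.Perm (Fin k)) : Equiv.Perm (Fin (k + l)) :=
  finSumFinEquiv.symm.trans ((Equiv.sumCongr σ (Equiv.refl (Fin l))).trans finSumFinEquiv)

/-- Antisymmetrizer of the first `k` factors of `V^{⊗(k+l)}`. -/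
def projAL (m : ℕ) (N k l : ℕ) : Matrix (Fin (k + l) → Fin N) (Fin (k + l) → Fin N) ℂ :=
  ((k.factorial : ℂ))⁻¹ •
    ∑ σ : Equiv.Perm (Fin k), (((Equiv.Perm.sign σ : ℤ) : ℂ)) • permMat m (· < ·) (extL σ)

/-- `R_{∧k,∧1}(u)` on `V^{⊗k} ⊗ V` (wedge factors first, single `V` last). -/
def Rdown (m : ℕ) (N k : ℕ) (u : ℂ) :
    Matrix (Fin (k + 1) → Fin N) (Fin (k + 1) → Fin N) ℂ :=
  u • 1 + ∑ a : Fin N, ∑ b : Fin N, ∑ i : Fin k,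
    ((-1 : ℂ) ^ par m b) •
      (embed m (· < ·) (Fin.castAdd 1 i) (Eunit a b) *
        embed m (· < ·) (Fin.natAdd k (0 : Fin 1)) (Eunit b a))

/-- `R_{∧1,∧k}(u)` realized on `Fin (k+1)`-indexed factors with the single `V` at position `0`
and the wedge factors at positions `1, …, k`. -/
def RupAt0 (m : ℕ) (N k : ℕ) (u : ℂ) :
    Matrix (Fin (k + 1) → Fin N) (Fin (k + 1) → Fin N) ℂ :=
  (u + (k : ℂ) - 1) • 1 + ∑ a : Fin N, ∑ b : Fin N, ∑ i : Fin k,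
    ((-1 : ℂ) ^ par m b) •
      (embed m (· < ·) (0 : Fin (k + 1)) (Eunit a b) *
        embed m (· < ·) (Fin.succ i) (Eunit b a))

/-- `(X)^{(21)}` : conjugation by the super flip exchanging the `V`-factor (at position 0)
with the block of the remaining `k` factors. -/
def swap21 (m : ℕ) (N k : ℕ) (X : Matrix (Fin (k + 1) → Fin N) (Fin (k + 1) → Fin N) ℂ) :
    Matrix (Fin (k + 1) → Fin N) (Fin (k + 1) → Fin N) ℂ :=
  permMat m (· < ·) (finRotate (k + 1))⁻¹ * X * permMat m (· < ·) (finRotate (k + 1))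

/-- Reindexing by a permutation a product of a symmetric function over the pairs `i < j`. -/
theorem prod_lt_comp_perm {K : ℕ} (τ : Equiv.Perm (Fin K)) (f : Fin K × Fin K → ℂ)
    (hf : ∀ p, f p.swap = f p) :
    ∏ p ∈ Finset.univ.filter (fun p : Fin K × Fin K => p.1 < p.2), f (τ p.1, τ p.2) =
      ∏ p ∈ Finset.univ.filter (fun p : Fin K × Fin K => p.1 < p.2), f p := by
  refine Finset.prod_bij'
    (fun p _ => if τ p.1 < τ p.2 then (τ p.1, τ p.2) else (τ p.2, τ p.1))
    (fun p _ => if τ.symm p.1 < τ.symm p.2 then (τ.symm p.1, τ.symm p.2)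
      else (τ.symm p.2, τ.symm p.1)) ?_ ?_ ?_ ?_ ?_
  · rintro ⟨x, y⟩ h
    have h' : x < y := by simpa using h
    have : τ x ≠ τ y := fun e => h'.ne (τ.injective e)
    simp only [Finset.mem_filter, Finset.mem_univ, true_and]
    split_ifs with h1
    · exact h1
    · exact lt_of_le_of_ne (not_lt.1 h1) this.symm
  · rintro ⟨x, y⟩ h
    have h' : x < y := by simpa using h
    have : τ.symm x ≠ τ.symm y := fun e => h'.ne (τ.symm.injective e)
    simp only [Finset.mem_filter, Finset.mem_univ, true_and]
    split_ifs with h1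
    · exact h1
    · exact lt_of_le_of_ne (not_lt.1 h1) this.symm
  · rintro ⟨x, y⟩ h
    have h' : x < y := by simpa using h
    by_cases h1 : τ x < τ y <;> simp [h1, h', h'.not_gt]
  · rintro ⟨x, y⟩ h
    have h' : x < y := by simpa using h
    by_cases h1 : τ.symm x < τ.symm y <;> simp [h1, h', h'.not_gt]
  · rintro ⟨x, y⟩ h
    dsimp only
    split_ifs with h1
    · rfl
    · exact (hf (τ x, τ y)).symm

theorem neg_one_pow_invExp_eq_prod {K : ℕ} (m : ℕ) (σ : Equiv.Perm (Fin K)) (s : Fin K → Fin N) :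
    (-1 : ℂ) ^ invExp m (· < ·) σ s =
      ∏ p ∈ Finset.univ.filter (fun p : Fin K × Fin K => p.1 < p.2),
        if (p.1 < p.2 ↔ σ p.1 < σ p.2) then 1 else (-1 : ℂ) ^ (par m (s p.1) * par m (s p.2)) := by
  rw [invExp, ← Finset.prod_pow_eq_pow_sum, ← Finset.filter_filter, Finset.prod_filter]
  refine Finset.prod_congr rfl ?_
  rintro ⟨x, y⟩ h
  have h' : x < y := by simpa using h
  have : σ x ≠ σ y := fun e => h'.ne (σ.injective e)
  rcases lt_or_gt_of_ne this with h1 | h1 <;> simp [h1, h', h1.not_gt]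

theorem neg_one_pow_invExp_mul {K : ℕ} (m : ℕ) (σ τ : Equiv.Perm (Fin K)) (s : Fin K → Fin N) :
    (-1 : ℂ) ^ invExp m (· < ·) (σ * τ) s =
      (-1 : ℂ) ^ invExp m (· < ·) σ (s ∘ τ.symm) * (-1 : ℂ) ^ invExp m (· < ·) τ s := by
  simp only [neg_one_pow_invExp_eq_prod]
  rw [← prod_lt_comp_perm τ (fun p => if (p.1 < p.2 ↔ σ p.1 < σ p.2) then (1 : ℂ)
    else (-1 : ℂ) ^ (par m ((s ∘ τ.symm) p.1) * par m ((s ∘ τ.symm) p.2))),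
    ← Finset.prod_mul_distrib]
  · refine Finset.prod_congr rfl ?_
    rintro ⟨x, y⟩ -
    have hsq : (-1 : ℂ) ^ (par m (s x) * par m (s y)) * (-1) ^ (par m (s x) * par m (s y)) = 1 := by
      rw [← mul_pow]; simp
    by_cases h1 : x < y <;> by_cases h2 : τ x < τ y <;> by_cases h3 : σ (τ x) < σ (τ y) <;>
      simp [h1, h2, h3, hsq]
  · rintro ⟨x, y⟩
    rcases eq_or_ne x y with rfl | hxy
    · rfl
    have hσ : σ x ≠ σ y := fun e => hxy (σ.injective e)
    have e1 : y < x ↔ ¬ x < y := ⟨fun h => h.not_gt, fun h => lt_of_le_of_ne (not_lt.1 h) hxy.symm⟩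
    have e2 : σ y < σ x ↔ ¬ σ x < σ y :=
      ⟨fun h => h.not_gt, fun h => lt_of_le_of_ne (not_lt.1 h) hσ.symm⟩
    simp only [Prod.swap, e1, e2, not_iff_not, mul_comm]

theorem permMat_mul {K : ℕ} (m : ℕ) (σ τ : Equiv.Perm (Fin K)) :
    (permMat m (· < ·) (σ * τ) : Matrix (Fin K → Fin N) (Fin K → Fin N) ℂ) =
      permMat m (· < ·) σ * permMat m (· < ·) τ := by
  ext r s
  rw [Matrix.mul_apply, Finset.sum_eq_single (s ∘ τ.symm)]
  · have : (s ∘ (σ * τ).symm : Fin K → Fin N) = (s ∘ τ.symm) ∘ σ.symm := rfl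
    simp only [permMat, this, neg_one_pow_invExp_mul, if_true, ite_mul, zero_mul]
  · intro t _ ht
    simp [permMat, ht]
  · simp

theorem permMat_one {K : ℕ} (m : ℕ) :
    (permMat m (· < ·) (1 : Equiv.Perm (Fin K)) : Matrix (Fin K → Fin N) (Fin K → Fin N) ℂ) =
      1 := by
  ext r s
  have h : invExp m (· < ·) (1 : Equiv.Perm (Fin K)) s = 0 := by
    rw [invExp, Finset.filter_false_of_mem, Finset.sum_empty]
    rintro ⟨x, y⟩ - ⟨h1, h2⟩
    exact lt_asymm h1 h2
  have h1 : (s ∘ (1 : Equiv.Perm (Fin K)).symm) = s := rfl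
  simp only [permMat, h, h1, Matrix.one_apply, pow_zero]

theorem invExp_swap {K : ℕ} (m : ℕ) {i j : Fin K} (hij : i < j) (s : Fin K → Fin N) :
    invExp m (· < ·) (Equiv.swap i j) s = par m (s i) * par m (s j) +
      (par m (s i) + par m (s j)) * ∑ w ∈ Finset.Ioo i j, par m (s w) := by
  have key : ∀ x y : Fin K,
      (if x < y ∧ Equiv.swap i j y < Equiv.swap i j x then par m (s x) * par m (s y) else 0) =
      (if x = i then if y = j then par m (s i) * par m (s j) else 0 else 0) +
      (if x = i then if y ∈ Finset.Ioo i j then par m (s i) * par m (s y) else 0 else 0) +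
      (if y = j then if x ∈ Finset.Ioo i j then par m (s x) * par m (s j) else 0 else 0) := by
    intro x y
    simp only [Equiv.swap_apply_def, Finset.mem_Ioo]
    grind
  rw [invExp, Finset.sum_filter, Fintype.sum_prod_type]
  simp only [key, Finset.sum_add_distrib]
  simp only [Finset.sum_ite_eq', Finset.sum_ite_irrel, Finset.sum_const_zero, Finset.mem_univ,
    if_true, Finset.sum_ite_mem, Finset.univ_inter, add_mul, Finset.mul_sum, Finset.sum_add_distrib, add_assoc]
  simp only [mul_comm]

theorem embed_Eunit_ne_zero {K m : ℕ} {v : Fin K} {a b : Fin N} {r s : Fin K → Fin N}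
    (h : embed m (· < ·) v (Eunit a b) r s ≠ 0) :
    (∀ w, w ≠ v → r w = s w) ∧ r v = a ∧ s v = b := by
  simp only [embed, Eunit] at h
  split_ifs at h with h1 h2
  · exact ⟨h1, h2⟩
  · simp at h
  · exact absurd rfl h

/-- The tensor `∑ (-1)^|b| E_ab ⊗ E_ba` placed in two tensor factors is the super flip of these
factors. -/
theorem sum_embed_mul_embed {K : ℕ} (m : ℕ) {i j : Fin K} (hij : i < j) :
    ∑ a : Fin N, ∑ b : Fin N, ((-1 : ℂ) ^ par m b) •
      (embed m (· < ·) i (Eunit a b) * embed m (· < ·) j (Eunit b a)) =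
      permMat m (· < ·) (Equiv.swap i j) := by
  ext r s
  simp only [Matrix.sum_apply, Matrix.smul_apply, smul_eq_mul]
  rw [Finset.sum_eq_single (s j), Finset.sum_eq_single (s i), Matrix.mul_apply,
    Finset.sum_eq_single (Function.update s j (s i))]
  · have hs : r = s ∘ (Equiv.swap i j).symm ↔
        (∀ w, w ≠ i → r w = Function.update s j (s i) w) ∧ r i = s j := by
      rw [funext_iff]
      simp only [Function.comp, Equiv.symm_swap, Equiv.swap_apply_def, Function.update_apply]
      grind
    have hlow : ∑ w ∈ Finset.univ.filter (fun w => w < i), par m (Function.update s j (s i) w) =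
        ∑ w ∈ Finset.univ.filter (fun w => w < i), par m (s w) := by
      refine Finset.sum_congr rfl fun w hw => ?_
      have : w < i := by simpa using hw
      rw [Function.update_of_ne (this.trans hij).ne]
    have hsplit : ∑ w ∈ Finset.univ.filter (fun w => w < j), par m (s w) =
        ∑ w ∈ Finset.univ.filter (fun w => w < i), par m (s w) + par m (s i) +
          ∑ w ∈ Finset.Ioo i j, par m (s w) := by
      have : Finset.univ.filter (fun w => w < j) =
          (insert i (Finset.univ.filter (fun w => w < i))) ∪ Finset.Ioo i j := by
        ext w; simp; grind
      rw [this, Finset.sum_union, Finset.sum_insert, add_comm (par m (s i))]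
      · simp
      · rw [Finset.disjoint_left]; intro w; simp; grind
    simp only [permMat, embed, Eunit, invExp_swap m hij]
    rw [if_congr hs rfl rfl]
    by_cases h1 : ∀ w, w ≠ i → r w = Function.update s j (s i) w
    · by_cases h2 : r i = s j
      · have h3 : ∀ w, w ≠ j → Function.update s j (s i) w = s w :=
          fun w hw => Function.update_of_ne hw _ _
        rw [if_pos h1, if_pos h3, if_pos (And.intro h1 h2), hlow, hsplit]
        rw [if_pos ⟨h2, Function.update_of_ne hij.ne _ _⟩, if_pos (by simp)]
        simp only [h2, Function.update_self, Function.update_of_ne hij.ne, mul_one, ← pow_add]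
        have hp : par m (s i) * par m (s i) = par m (s i) := by
          unfold par parN
          split_ifs <;> rfl
        generalize ∑ w ∈ Finset.univ.filter (fun w => w < i), par m (s w) = L
        generalize ∑ w ∈ Finset.Ioo i j, par m (s w) = M
        generalize par m (s i) = p at hp ⊢
        generalize par m (s j) = q
        have he : p + ((q + p) * L + (p + q) * (L + p + M)) =
            p * q + (p + q) * M + 2 * (p + (p + q) * L) := by
          linear_combination hp
        rw [he, pow_add _ _ (2 * _), pow_mul]
        simp
      · simp [h2]
    · simp [h1]
  · intro t _ ht
    by_contra h
    obtain ⟨h1, h2⟩ := mul_ne_zero_iff.1 h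
    obtain ⟨h3, h4, -⟩ := embed_Eunit_ne_zero h2
    exact ht (Function.eq_update_iff.2 ⟨h4, h3⟩)
  · simp
  · intro b _ hb
    rw [Matrix.mul_apply, Finset.sum_eq_zero, mul_zero]
    intro t _
    by_contra h
    obtain ⟨h1, h2⟩ := mul_ne_zero_iff.1 h
    obtain ⟨-, -, h3⟩ := embed_Eunit_ne_zero h1
    obtain ⟨h4, -, -⟩ := embed_Eunit_ne_zero h2
    exact hb (h3.symm.trans (h4 i hij.ne))
  · simp
  · intro a _ ha
    refine Finset.sum_eq_zero fun b _ => ?_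
    rw [Matrix.mul_apply, Finset.sum_eq_zero, mul_zero]
    intro t _
    by_contra h
    obtain ⟨-, -, h3⟩ := embed_Eunit_ne_zero (mul_ne_zero_iff.1 h).2
    exact ha h3.symm
  · simp

theorem extL_mul {k l : ℕ} (σ τ : Equiv.Perm (Fin k)) :
    (extL (σ * τ) : Equiv.Perm (Fin (k + l))) = extL σ * extL τ := by
  ext x
  refine Fin.addCases (fun x => ?_) (fun x => ?_) x <;> simp [extL]

theorem extL_swap {k l : ℕ} (i j : Fin k) :
    (extL (Equiv.swap i j) : Equiv.Perm (Fin (k + l))) =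
      Equiv.swap (Fin.castAdd l i) (Fin.castAdd l j) := by
  ext x
  refine Fin.addCases (fun x => ?_) (fun x => ?_) x
  · rw [(Fin.castAdd_injective k l).swap_apply]
    simp [extL, -Equiv.Perm.sumCongr_swap_refl]
  · have h : ∀ y : Fin k, Fin.natAdd k x ≠ Fin.castAdd l y := fun y h => by
      have := congrArg Fin.val h
      simp at this
      omega
    rw [Equiv.swap_apply_of_ne_of_ne (h i) (h j)]
    simp [extL, -Equiv.Perm.sumCongr_swap_refl]

theorem permMat_swap_mul_projAL (m N l : ℕ) {k : ℕ} {i j : Fin k} (hij : i ≠ j) :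
    permMat m (· < ·) (Equiv.swap (Fin.castAdd l i) (Fin.castAdd l j)) * projAL m N k l =
      -projAL m N k l := by
  rw [projAL, Matrix.mul_smul, Matrix.mul_sum, ← smul_neg, ← Finset.sum_neg_distrib]
  congr 1
  refine Fintype.sum_equiv (Equiv.mulLeft (Equiv.swap i j)) _ _ fun σ => ?_
  rw [Matrix.mul_smul, ← extL_swap, ← permMat_mul, ← extL_mul]
  simp [Equiv.Perm.sign_swap hij]

theorem statement2 (m n k : ℕ) (hk : 1 ≤ k) : ∀ u : ℂ,
    Rdown m (m + n) k u * swap21 m (m + n) k (RupAt0 m (m + n) k (-u)) * projAL m (m + n) k 1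
      = ((u + 1) * ((k : ℂ) - u)) • projAL m (m + n) k 1 := by
  intro u
  set P : Fin k → Matrix (Fin (k + 1) → Fin (m + n)) (Fin (k + 1) → Fin (m + n)) ℂ :=
    fun i => permMat m (· < ·) (Equiv.swap (Fin.castAdd 1 i) (Fin.last k)) with hP
  set A := projAL m (m + n) k 1 with hA
  have hdown : Rdown m (m + n) k u = u • 1 + ∑ i, P i := by
    rw [Rdown]
    congr 1
    rw [Finset.sum_congr rfl fun a _ => Finset.sum_comm, Finset.sum_comm]
    exact Finset.sum_congr rfl fun i _ => sum_embed_mul_embed m (Fin.castSucc_lt_last i)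
  have hup : RupAt0 m (m + n) k (-u) = (-u + (k : ℂ) - 1) • 1 +
      ∑ i : Fin k, permMat m (· < ·) (Equiv.swap 0 i.succ) := by
    rw [RupAt0]
    congr 1
    rw [Finset.sum_congr rfl fun a _ => Finset.sum_comm, Finset.sum_comm]
    exact Finset.sum_congr rfl fun i _ => sum_embed_mul_embed m (Fin.succ_pos i)
  have hswap : swap21 m (m + n) k (RupAt0 m (m + n) k (-u)) =
      (-u + (k : ℂ) - 1) • 1 + ∑ i, P i := by
    rw [swap21, hup, mul_add, add_mul, Matrix.mul_smul, mul_one, Matrix.smul_mul,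
      ← permMat_mul, inv_mul_cancel, permMat_one, Matrix.mul_sum, Matrix.sum_mul]
    congr 1
    refine Finset.sum_congr rfl fun i _ => ?_
    rw [← permMat_mul, ← permMat_mul, hP]
    congr 1
    have h0 : (finRotate (k + 1))⁻¹ 0 = Fin.last k := by
      rw [Equiv.Perm.inv_eq_iff_eq, finRotate_last]
    have hi : (finRotate (k + 1))⁻¹ i.succ = Fin.castAdd 1 i := by
      rw [Equiv.Perm.inv_eq_iff_eq]
      exact (finRotate_of_lt i.2).symm
    have := Equiv.mul_swap_eq_swap_mul (finRotate (k + 1))⁻¹ 0 i.succ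
    rw [this, inv_mul_cancel_right, h0, hi, Equiv.swap_comm]
  have hPP : ∀ i j, P i * (P j * A) = if i = j then A else -(P j * A) := by
    intro i j
    split_ifs with h
    · subst h
      rw [← mul_assoc, hP, ← permMat_mul, Equiv.swap_mul_self, permMat_one, one_mul]
    · have hc : Equiv.swap (Fin.castAdd 1 i) (Fin.last k) * Equiv.swap (Fin.castAdd 1 j) (Fin.last k)
          = Equiv.swap (Fin.castAdd 1 j) (Fin.last k) *
            Equiv.swap (Fin.castAdd 1 i) (Fin.castAdd 1 j) := by
        have hi : Fin.castAdd 1 i ≠ Fin.last k := (Fin.castSucc_lt_last i).ne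
        have hj : Fin.castAdd 1 j ≠ Fin.last k := (Fin.castSucc_lt_last j).ne
        have hn : Fin.castAdd 1 i ≠ Fin.castAdd 1 j := fun e => h (Fin.castAdd_injective _ _ e)
        rw [Equiv.mul_swap_eq_swap_mul (Equiv.swap (Fin.castAdd 1 j) (Fin.last k)),
          Equiv.swap_apply_left, Equiv.swap_apply_of_ne_of_ne hn hi]
      rw [← mul_assoc, hP, ← permMat_mul, hc, permMat_mul, mul_assoc,
        permMat_swap_mul_projAL m _ 1 h, mul_neg]
  have hSS : (∑ i, P i) * ((∑ i, P i) * A) = (k : ℂ) • A - ((k : ℂ) - 1) • ((∑ i, P i) * A) := by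
    have hrow : ∀ j, ∑ i, P i * (P j * A) = A - ((k : ℂ) - 1) • (P j * A) := by
      intro j
      have : ∀ i, P i * (P j * A) = (if i = j then A + P j * A else 0) - P j * A := by
        intro i
        rw [hPP]
        split_ifs <;> simp
      simp only [this, Finset.sum_sub_distrib, Finset.sum_ite_eq', Finset.mem_univ, if_true,
        Finset.sum_const, Finset.card_univ, Fintype.card_fin, sub_smul, one_smul,
        Nat.cast_smul_eq_nsmul]
      abel
    rw [Finset.sum_mul, Finset.sum_mul]
    simp_rw [Finset.mul_sum]
    rw [Finset.sum_comm]
    simp only [hrow, Finset.sum_sub_distrib, Finset.sum_const, Finset.card_univ, Fintype.card_fin,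
      Finset.smul_sum, Nat.cast_smul_eq_nsmul]
  rw [hdown, hswap, mul_assoc, add_mul _ _ A, Matrix.smul_mul, one_mul, add_mul, mul_add, mul_add,
    hSS]
  simp only [Matrix.smul_mul, Matrix.mul_smul, one_mul]
  module

end Paper
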